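/- For every integer k ≥ 213, M_k > log(k) − 2 log(log(k)) − 2, where M_k = sup_{F ∈ 𝒮_k} (Σ_{i=1}^k J_k^{(i)}(F))/I_k(F). -/

import Mathlib

open MeasureTheory

/-- The simplex `ℛ_k = {x ∈ [0,1]^k : Σ x_i ≤ 1}`. -/
def maynardSimplex (k : ℕ) : Set (Fin k → ℝ) :=
  {t | (∀ i, t i ∈ Set.Icc (0 : ℝ) 1) ∧ ∑ i, t i ≤ 1}

/-- `I_k(F) = ∫_{[0,1]^k} F(t)² dt`. -/
noncomputable def maynardI (k : ℕ) (F : (Fin k → ℝ) → ℝ) : ℝ :=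
  ∫ t in Set.univ.pi fun _ : Fin k => Set.Icc (0 : ℝ) 1, F t ^ 2

/-- `J_k^{(i)}(F) = ∫_{[0,1]^{k-1}} (∫_0^1 F(t) dt_i)² dt_1⋯dt_{i-1}dt_{i+1}⋯dt_k`
(written as an integral over `[0,1]^k`, the inner function being independent of `t i`). -/
noncomputable def maynardJ (k : ℕ) (i : Fin k) (F : (Fin k → ℝ) → ℝ) : ℝ :=
  ∫ t in Set.univ.pi fun _ : Fin k => Set.Icc (0 : ℝ) 1,
    (∫ x in (0:ℝ)..1, F (Function.update t i x)) ^ 2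

/-- The class `𝒮_k` of infinitely differentiable functions supported on `ℛ_k` with
`I_k(F) ≠ 0` and `J_k^{(i)}(F) ≠ 0` for all `i`. -/
def maynardS (k : ℕ) : Set ((Fin k → ℝ) → ℝ) :=
  {F | ContDiff ℝ (⊤ : ℕ∞) F ∧ Function.support F ⊆ maynardSimplex k ∧
    maynardI k F ≠ 0 ∧ ∀ i, maynardJ k i F ≠ 0}

/-- `M_k = sup_{F ∈ 𝒮_k} (Σ_i J_k^{(i)}(F)) / I_k(F)`. -/
noncomputable def maynardM (k : ℕ) : ℝ :=
  sSup {r : ℝ | ∃ F ∈ maynardS k, r = (∑ i, maynardJ k i F) / maynardI k F}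

/-- Lebesgue measure on the unit interval. -/
noncomputable def nu01 : Measure ℝ := volume.restrict (Set.Icc (0:ℝ) 1)

instance : IsProbabilityMeasure nu01 := ⟨by simp [nu01]⟩

lemma nu01_cube (k : ℕ) : (volume : Measure (Fin k → ℝ)).restrict
    (Set.univ.pi fun _ : Fin k => Set.Icc (0 : ℝ) 1) = Measure.pi (fun _ => nu01) := by
  rw [volume_pi, Measure.restrict_pi_pi]; rfl

lemma nu01_interval (f : ℝ → ℝ) : ∫ x in (0:ℝ)..1, f x = ∫ x, f x ∂nu01 := by
  rw [intervalIntegral.integral_of_le zero_le_one, nu01, integral_Icc_eq_integral_Ioc]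

lemma nu01_integrable {f : ℝ → ℝ} (hf : Continuous f) : Integrable f nu01 :=
  hf.continuousOn.integrableOn_compact isCompact_Icc

lemma cube_integrable {k : ℕ} {f : (Fin k → ℝ) → ℝ} (hf : Continuous f) :
    Integrable f (Measure.pi (fun _ : Fin k => nu01)) := by
  rw [← nu01_cube]
  exact hf.continuousOn.integrableOn_compact (isCompact_univ_pi fun _ => isCompact_Icc)

lemma cube_ae (k : ℕ) : ∀ᵐ t ∂(Measure.pi (fun _ : Fin k => nu01)),
    ∀ i, t i ∈ Set.Icc (0:ℝ) 1 := by
  rw [← nu01_cube]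
  filter_upwards [ae_restrict_mem (MeasurableSet.univ_pi fun _ => measurableSet_Icc)] with t ht i
  exact ht i (Set.mem_univ _)

lemma map_update (k : ℕ) (i : Fin k) :
    ((Measure.pi (fun _ : Fin k => nu01)).prod nu01).map
      (fun p : (Fin k → ℝ) × ℝ => Function.update p.1 i p.2) = Measure.pi (fun _ => nu01) := by
  have hm : Measurable (fun p : (Fin k → ℝ) × ℝ => Function.update p.1 i p.2) := by
    have : Continuous (fun p : (Fin k → ℝ) × ℝ => Function.update p.1 i p.2) :=
      continuous_fst.update i continuous_snd
    exact this.measurable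
  symm
  apply Measure.pi_eq
  intro s hs
  rw [Measure.map_apply hm (MeasurableSet.univ_pi hs)]
  have : (fun p : (Fin k → ℝ) × ℝ => Function.update p.1 i p.2) ⁻¹' (Set.univ.pi s)
      = (Set.univ.pi (Function.update s i Set.univ)) ×ˢ (s i) := by
    ext ⟨t, x⟩
    simp only [Set.mem_preimage, Set.mem_pi, Set.mem_univ, true_implies, Set.mem_prod]
    constructor
    · intro h
      refine ⟨fun j => ?_, by simpa using h i⟩
      by_cases hj : j = i
      · subst hj; simp
      · simpa [hj] using h j
    · rintro ⟨h, hx⟩ j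
      by_cases hj : j = i
      · subst hj; simpa using hx
      · simpa [hj] using h j
  rw [this, Measure.prod_prod, Measure.pi_pi, ← Finset.mul_prod_erase _ _ (Finset.mem_univ i),
    ← Finset.mul_prod_erase (a := i) Finset.univ (fun j => nu01 (s j)) (Finset.mem_univ i)]
  simp only [Function.update_self, measure_univ, one_mul]
  rw [mul_comm]
  congr 1
  apply Finset.prod_congr rfl
  intro j hj
  rw [Function.update_of_ne (Finset.ne_of_mem_erase hj)]

lemma sq_integral_le {f : ℝ → ℝ} (hf : Continuous f) :
    (∫ x, f x ∂nu01)^2 ≤ ∫ x, f x ^ 2 ∂nu01 := by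
  set c := ∫ x, f x ∂nu01 with hc
  have h0 : 0 ≤ ∫ x, (f x - c)^2 ∂nu01 := integral_nonneg fun x => sq_nonneg _
  have h1 : ∫ x, (f x - c)^2 ∂nu01 = ∫ x, f x ^ 2 ∂nu01 - c^2 := by
    have : ∀ x, (f x - c)^2 = (f x^2 - 2 * c * f x) + c^2 := fun x => by ring
    simp_rw [this]
    rw [integral_add (nu01_integrable (by fun_prop)) (nu01_integrable (by fun_prop)),
      integral_sub (nu01_integrable (by fun_prop)) (nu01_integrable (by fun_prop)),
      integral_const_mul, ← hc]
    simp
    ring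
  linarith

lemma maynardJ_eq (k : ℕ) (i : Fin k) (F : (Fin k → ℝ) → ℝ) :
    maynardJ k i F = ∫ t, (∫ x, F (Function.update t i x) ∂nu01)^2 ∂(Measure.pi fun _ => nu01) := by
  unfold maynardJ
  rw [nu01_cube]
  simp_rw [nu01_interval]

lemma maynardI_eq (k : ℕ) (F : (Fin k → ℝ) → ℝ) :
    maynardI k F = ∫ t, F t ^ 2 ∂(Measure.pi fun _ => nu01) := by
  unfold maynardI
  rw [nu01_cube]

lemma inner_continuous {k : ℕ} (i : Fin k) {F : (Fin k → ℝ) → ℝ} (hF : Continuous F) :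
    Continuous fun t => ∫ x, F (Function.update t i x) ∂nu01 := by
  simp_rw [← nu01_interval]
  apply intervalIntegral.continuous_parametric_intervalIntegral_of_continuous' (μ := volume)
  exact hF.comp (continuous_fst.update i continuous_snd)

lemma maynardJ_le_I (k : ℕ) (i : Fin k) {F : (Fin k → ℝ) → ℝ} (hF : Continuous F) :
    maynardJ k i F ≤ maynardI k F := by
  rw [maynardJ_eq, maynardI_eq]
  have hu : Continuous (fun p : (Fin k → ℝ) × ℝ => Function.update p.1 i p.2) :=
      continuous_fst.update i continuous_snd
  have hF2 : Continuous (fun t => F t ^ 2) := by fun_prop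
  calc _ ≤ ∫ t, (∫ x, F (Function.update t i x)^2 ∂nu01) ∂(Measure.pi fun _ => nu01) := by
        apply integral_mono
        · exact cube_integrable ((inner_continuous i hF).pow 2)
        · exact cube_integrable (inner_continuous (F := fun t => F t ^ 2) i hF2)
        · intro t
          apply sq_integral_le
          exact hF.comp (continuous_const.update i continuous_id)
    _ = _ := by
        conv_rhs => rw [← map_update k i]
        rw [integral_map hu.aemeasurable hF2.aestronglyMeasurable, integral_prod]
        have := cube_integrable hF2
        rw [← map_update k i, integrable_map_measure hF2.aestronglyMeasurable hu.aemeasurable] at this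
        exact this

lemma le_maynardM (k : ℕ) {F : (Fin k → ℝ) → ℝ} (hF : F ∈ maynardS k) :
    (∑ i, maynardJ k i F) / maynardI k F ≤ maynardM k := by
  apply le_csSup
  · refine ⟨k, ?_⟩
    rintro r ⟨F, ⟨hF, -, hI, -⟩, rfl⟩
    have hI0 : 0 ≤ maynardI k F := by
      rw [maynardI_eq]; exact integral_nonneg fun t => sq_nonneg _
    rw [div_le_iff₀ (lt_of_le_of_ne hI0 hI.symm)]
    calc _ ≤ ∑ i : Fin k, maynardI k F := Finset.sum_le_sum fun i _ => maynardJ_le_I k i hF.continuous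
      _ = _ := by simp
  · exact ⟨F, hF, rfl⟩

lemma second_moment (k : ℕ) (f h : Fin k → ℝ → ℝ) (v : ℝ) (hf : ∀ j, Continuous (f j))
    (hh : ∀ j, Continuous (h j)) (h0 : ∀ j, ∫ x, f j x ∂nu01 = 1)
    (h1 : ∀ j, ∫ x, f j x * h j x ∂nu01 = 0) (h2 : ∀ j, ∫ x, f j x * h j x ^ 2 ∂nu01 ≤ v) :
    ∫ t, (∏ j, f j (t j)) * (∑ j, h j (t j))^2 ∂(Measure.pi fun _ : Fin k => nu01) ≤ k * v := by
  have e : ∀ t : Fin k → ℝ, (∏ j, f j (t j)) * (∑ j, h j (t j))^2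
      = ∑ a, ∑ b, ∏ j, (f j (t j) * (if j = a then h j (t j) else 1)
          * (if j = b then h j (t j) else 1)) := by
    intro t
    rw [sq, Finset.sum_mul_sum, Finset.mul_sum]
    refine Finset.sum_congr rfl fun a _ => ?_
    rw [Finset.mul_sum]
    refine Finset.sum_congr rfl fun b _ => ?_
    rw [Finset.prod_mul_distrib, Finset.prod_mul_distrib]
    simp [mul_assoc]
  have hc : ∀ a b j, Continuous fun x => (f j x * (if j = a then h j x else 1)
          * (if j = b then h j x else 1)) := by
    intro a b j
    have := hf j
    have := hh j
    split_ifs <;> fun_prop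
  simp_rw [e]
  rw [integral_finsetSum]
  swap
  · intro a _
    apply integrable_finsetSum
    intro b _
    apply cube_integrable
    exact continuous_finsetProd _ fun j _ => (hc a b j).comp (continuous_apply j)
  calc _ ≤ ∑ a : Fin k, v := by
        refine Finset.sum_le_sum fun a _ => ?_
        rw [integral_finsetSum]
        swap
        · intro b _
          apply cube_integrable
          exact continuous_finsetProd _ fun j _ => (hc a b j).comp (continuous_apply j)
        rw [Finset.sum_eq_single a]
        · rw [integral_fintype_prod_eq_prod (𝕜 := ℝ) (fun j x => f j x * (if j = a then h j x else 1)
          * (if j = a then h j x else 1)), Finset.prod_eq_single a]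
          · simpa [sq, mul_assoc] using h2 a
          · intro j _ hj
            simpa [hj] using h0 j
          · simp
        · intro b _ hb
          rw [integral_fintype_prod_eq_prod (𝕜 := ℝ) (fun j x => f j x * (if j = a then h j x else 1)
          * (if j = b then h j x else 1))]
          apply Finset.prod_eq_zero (Finset.mem_univ a)
          simpa [hb.symm] using h1 a
        · simp
    _ = _ := by simp

lemma core (k : ℕ) (hk : 1 ≤ k) (g : ℝ → ℝ) (τ ε m : ℝ) (hg : ContDiff ℝ (⊤ : ℕ∞) g)
    (hg0 : ∀ x, 0 ≤ g x) (hs : ∀ x, g x ≠ 0 → 0 ≤ x ∧ x ≤ τ) (hτ : τ ≤ 1) (hε : 0 < ε)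
    (h1 : ∫ x, g x ^ 2 ∂nu01 = 1) (hm : ∫ x, x * g x ^ 2 ∂nu01 = m)
    (hD : 0 < 1 - ε - τ - k * m) (hX : 0 < 1 - k * τ * m / (1 - ε - τ - k * m)^2)
    (hG : 0 < ∫ x, g x ∂nu01) :
    k * (∫ x, g x ∂nu01)^2 * (1 - k * τ * m / (1 - ε - τ - k * m)^2) ≤ maynardM k := by
  set G := ∫ x, g x ∂nu01 with hGd
  set D := 1 - ε - τ - k * m with hDd
  have hgc : Continuous g := hg.continuous
  have hm0 : 0 ≤ m := by
    rw [← hm]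
    apply integral_nonneg
    intro x
    by_cases hx : g x = 0
    · simp [hx]
    · exact mul_nonneg (hs x hx).1 (sq_nonneg _)
  set χ : ℝ → ℝ := fun x => Real.smoothTransition ((1 - x) / ε) with hχ
  have hχs : ContDiff ℝ (⊤ : ℕ∞) χ := by
    apply Real.smoothTransition.contDiff.comp
    fun_prop
  have hχ0 : ∀ x, 0 ≤ χ x := fun x => Real.smoothTransition.nonneg _
  have hχ1 : ∀ x, χ x ≤ 1 := fun x => Real.smoothTransition.le_one _
  have hχe : ∀ x, x ≤ 1 - ε → χ x = 1 := by
    intro x hx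
    apply Real.smoothTransition.one_of_one_le
    rw [le_div_iff₀ hε]; linarith
  have hχz : ∀ x, χ x ≠ 0 → x ≤ 1 := by
    intro x hx
    by_contra h
    push Not at h
    apply hx
    apply Real.smoothTransition.zero_of_nonpos
    apply div_nonpos_of_nonpos_of_nonneg <;> linarith
  set F : (Fin k → ℝ) → ℝ := fun t => (∏ j, g (t j)) * χ (∑ j, t j) with hF
  have hFs : ContDiff ℝ (⊤ : ℕ∞) F := by
    apply ContDiff.mul
    · apply contDiff_prod
      intro j _
      exact hg.comp (contDiff_apply ℝ ℝ j)
    · apply hχs.comp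
      apply ContDiff.sum
      intro j _
      exact contDiff_apply ℝ ℝ j
  have hFc : Continuous F := hFs.continuous
  have hFsupp : Function.support F ⊆ maynardSimplex k := by
    intro t ht
    have ht' : (∏ j, g (t j)) * χ (∑ j, t j) ≠ 0 := ht
    have h3 := left_ne_zero_of_mul ht'
    have h4 := right_ne_zero_of_mul ht'
    refine ⟨fun j => ?_, hχz _ h4⟩
    have := hs _ (Finset.prod_ne_zero_iff.mp h3 j (Finset.mem_univ _))
    exact ⟨this.1, this.2.trans hτ⟩
  have hI : maynardI k F ≤ 1 := by
    rw [maynardI_eq]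
    calc _ ≤ ∫ t, ∏ j, g (t j)^2 ∂(Measure.pi fun _ : Fin k => nu01) := by
          apply integral_mono
          · exact cube_integrable (by fun_prop)
          · exact cube_integrable (by fun_prop)
          · intro t
            simp only [hF, mul_pow]
            rw [Finset.prod_pow]
            apply mul_le_of_le_one_right (sq_nonneg _)
            exact pow_le_one₀ (hχ0 _) (hχ1 _)
      _ = 1 := by
          rw [integral_fintype_prod_eq_prod (𝕜 := ℝ) (fun j x => g x ^ 2)]
          simp [h1]
  have hJ : ∀ i, G^2 * (1 - k * τ * m / D^2) ≤ maynardJ k i F := by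
    intro i
    set f : Fin k → ℝ → ℝ := fun j x => if j = i then 1 else g x ^ 2 with hf
    set h : Fin k → ℝ → ℝ := fun j x => if j = i then 0 else x - m with hh
    have hfc : ∀ j, Continuous (f j) := by
      intro j; simp only [hf]; split_ifs <;> fun_prop
    have hhc : ∀ j, Continuous (h j) := by
      intro j; simp only [hh]; split_ifs <;> fun_prop
    have hsm := second_moment k f h (τ * m) hfc hhc
      (by intro j; simp only [hf]; split_ifs
          · simp
          · exact h1)
      (by intro j; simp only [hf, hh]; split_ifs
          · simp
          · have : ∀ x, g x ^ 2 * (x - m) = x * g x ^ 2 - m * g x ^ 2 := fun x => by ring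
            simp_rw [this]
            rw [integral_sub (nu01_integrable (by fun_prop)) (nu01_integrable (by fun_prop)),
              integral_const_mul, h1, hm]; ring)
      (by intro j; simp only [hf, hh]; split_ifs with hj
          · have : 0 ≤ τ := by
              by_contra hcon
              have : ∀ x, g x = 0 := by
                intro x; by_contra hx; have := hs x hx; linarith
              simp [this] at h1
            simp; positivity
          · calc _ ≤ ∫ x, (τ * (x * g x ^ 2) - 2 * m * (x * g x ^2) + m^2 * g x ^2) ∂nu01 := by
                  apply integral_mono (nu01_integrable (by fun_prop)) (nu01_integrable (by fun_prop))
                  intro x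
                  simp only
                  by_cases hx : g x = 0
                  · simp [hx]
                  · have := hs x hx
                    have h5 : x * (τ - x) * g x ^ 2 ≥ 0 :=
                      mul_nonneg (mul_nonneg this.1 (by linarith)) (sq_nonneg _)
                    linarith
              _ = τ * m - m^2 := by
                  rw [integral_add (nu01_integrable (by fun_prop)) (nu01_integrable (by fun_prop)),
                    integral_sub (nu01_integrable (by fun_prop)) (nu01_integrable (by fun_prop)),
                    integral_const_mul, integral_const_mul, integral_const_mul, h1, hm]
                  ring
              _ ≤ τ * m := by linarith [sq_nonneg m])
    have hfp : ∫ t, (∏ j, f j (t j)) ∂(Measure.pi fun _ : Fin k => nu01) = 1 := by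
      rw [integral_fintype_prod_eq_prod (𝕜 := ℝ) f]
      apply Finset.prod_eq_one
      intro j _
      simp only [hf]; split_ifs
      · simp
      · exact h1
    have hpc : Continuous fun t : Fin k → ℝ => ∏ j, f j (t j) :=
      continuous_finsetProd _ fun j _ => (hfc j).comp (continuous_apply j)
    have hsc : Continuous fun t : Fin k → ℝ => ∑ j, h j (t j) :=
      continuous_finsetSum _ fun j _ => (hhc j).comp (continuous_apply j)
    rw [maynardJ_eq]
    calc G^2 * (1 - k * τ * m / D^2)
        ≤ G^2 * (1 - (∫ t, (∏ j, f j (t j)) * (∑ j, h j (t j))^2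
            ∂(Measure.pi fun _ : Fin k => nu01)) / D^2) := by
          gcongr; linarith
      _ = ∫ t, G^2 * ((∏ j, f j (t j)) - (∏ j, f j (t j)) * (∑ j, h j (t j))^2 / D^2)
            ∂(Measure.pi fun _ : Fin k => nu01) := by
          rw [integral_const_mul, integral_sub (cube_integrable hpc)
            (cube_integrable (by fun_prop)), integral_div, hfp]
      _ ≤ _ := by
          apply integral_mono_ae (cube_integrable (by fun_prop))
            (cube_integrable ((inner_continuous i hFc).pow 2))
          filter_upwards with t
          set P := ∏ j ∈ Finset.univ.erase i, g (t j) with hP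
          have hPf : ∏ j, f j (t j) = P^2 := by
            rw [← Finset.mul_prod_erase _ _ (Finset.mem_univ i), hP, ← Finset.prod_pow]
            simp only [hf, if_true, one_mul]
            apply Finset.prod_congr rfl
            intro j hj
            rw [if_neg (Finset.ne_of_mem_erase hj)]
          set S := ∑ j ∈ Finset.univ.erase i, t j with hS
          have hSh : ∑ j, h j (t j) = S - (k - 1) * m := by
            rw [← Finset.add_sum_erase _ _ (Finset.mem_univ i)]
            simp only [hh, if_true, zero_add]
            rw [Finset.sum_congr rfl (g := fun j => t j - m)]
            · rw [Finset.sum_sub_distrib, Finset.sum_const, Finset.card_erase_of_mem (Finset.mem_univ i)]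
              simp [Nat.cast_sub hk, hS]
            · intro j hj
              rw [if_neg (Finset.ne_of_mem_erase hj)]
          simp only [hPf, hSh]
          by_cases hc : S ≤ 1 - ε - τ
          · have hin : ∀ x, F (Function.update t i x) = P * g x := by
              intro x
              simp only [hF]
              rw [← Finset.mul_prod_erase _ _ (Finset.mem_univ i),
                ← Finset.add_sum_erase _ _ (Finset.mem_univ i)]
              rw [Finset.prod_congr rfl (g := fun j => g (t j))
                (fun j hj => by rw [Function.update_of_ne (Finset.ne_of_mem_erase hj)]),
                Finset.sum_congr rfl (g := fun j => t j)
                (fun j hj => by rw [Function.update_of_ne (Finset.ne_of_mem_erase hj)])]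
              simp only [Function.update_self]
              by_cases hx : g x = 0
              · simp [hx]
              · rw [hχe]
                · rw [hP]; ring
                · have := (hs x hx).2
                  linarith
            have hin2 : (∫ x, F (Function.update t i x) ∂nu01) = P * G := by
              simp_rw [hin]
              rw [integral_const_mul, ← hGd]
            change _ ≤ (∫ x, F (Function.update t i x) ∂nu01)^2
            rw [hin2, mul_pow, mul_comm (P^2) (G^2)]
            gcongr
            have : 0 ≤ P ^ 2 * (S - (k - 1) * m) ^ 2 / D ^ 2 := by positivity
            linarith
          · push Not at hc
            have h6 : D ≤ S - (k-1) * m := by linarith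
            have h7 : D^2 ≤ (S - (k-1) * m)^2 := by gcongr
            have h8 : P^2 ≤ P^2 * (S - (k-1) * m)^2 / D^2 := by
              rw [le_div_iff₀ (by positivity)]
              gcongr
            have h9 : G^2 * (P^2 - P^2 * (S - (k-1) * m)^2 / D^2) ≤ 0 :=
              mul_nonpos_of_nonneg_of_nonpos (sq_nonneg _) (by linarith)
            exact h9.trans (sq_nonneg _)
  have hpos : 0 < G^2 * (1 - k * τ * m / D^2) := by positivity
  have hJ0 : ∀ i, 0 < maynardJ k i F := fun i => hpos.trans_le (hJ i)
  have hI0 : 0 < maynardI k F := (hJ0 ⟨0, hk⟩).trans_le (maynardJ_le_I k _ hFc)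
  refine le_trans ?_ (le_maynardM k ⟨hFs, hFsupp, hI0.ne', fun i => (hJ0 i).ne'⟩)
  rw [le_div_iff₀ hI0]
  calc _ ≤ k * G^2 * (1 - k * τ * m / D^2) * 1 := by
        apply mul_le_mul_of_nonneg_left hI
        positivity
    _ = ∑ i : Fin k, G^2 * (1 - k * τ * m / D^2) := by simp; ring
    _ ≤ _ := Finset.sum_le_sum fun i _ => hJ i

/-- final numerical inequality -/
lemma num_final (k : ℕ) (hk : 213 ≤ k) (L A : ℝ) (hL : L = Real.log k) (hA : A = L - 2 * Real.log L)
   : 5.2 ≤ L ∧ 1.8 ≤ A ∧ A < L ∧ Real.exp A = k / L^2 := by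
  have hk0 : (213:ℝ) ≤ k := by exact_mod_cast hk
  have h1 : (5.2:ℝ) ≤ L := by
    have h3 : Real.log 213 ≤ L := by rw [hL]; exact Real.log_le_log (by norm_num) hk0
    have h4 : Real.log 213 = 7 * Real.log 2 - Real.log (128/213) := by
      rw [Real.log_div (by norm_num) (by norm_num), show (128:ℝ) = 2^7 by norm_num, Real.log_pow]; push_cast; ring
    have h5 : Real.log (128/213) ≤ 128/213 - 1 := Real.log_le_sub_one_of_pos (by norm_num)
    have := Real.log_two_gt_d9
    norm_num at *
    linarith
  have hL0 : 0 < L := by linarith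
  have h2 : Real.log L ≤ Real.log 2 + L / (2 * Real.exp 1) := by
    have h3 : Real.log (L / (2 * Real.exp 1)) ≤ L / (2 * Real.exp 1) - 1 :=
      Real.log_le_sub_one_of_pos (by positivity)
    rw [Real.log_div (by positivity) (by positivity), Real.log_mul (by norm_num) (by positivity), Real.log_exp] at h3
    linarith
  have he := Real.exp_one_gt_d9
  have h3 : L / (2 * Real.exp 1) ≤ L * 0.185 := by
    rw [div_le_iff₀ (by positivity)]
    nlinarith
  have := Real.log_two_lt_d9
  have h4 : 0 < Real.log L := Real.log_pos (by linarith)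
  refine ⟨h1, by norm_num at *; linarith, by linarith, ?_⟩
  rw [hA, Real.exp_sub, hL, Real.exp_log (by linarith), ← hL, two_mul, Real.exp_add, Real.exp_log hL0, sq]

lemma num_aux (L A W Y : ℝ) (h1 : 26 / 5 ≤ L) (h2 : 9 / 5 ≤ A) (h3 : A < L) 
    (hW : 11 / 20 ≤ W) (hW3 : 3 ≤ A → 71 / 100 ≤ W) (hX : A * Y * (L * W)^2 ≤ A^2) :
    Y < 1 ∧ A * Y < 2 := by
  have hLW : 11 / 20 * L ≤ L * W := by
    rw [mul_comm]; exact mul_le_mul_of_nonneg_left hW (by linarith)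
  have hLW3 : 3 ≤ A → 71 / 100 * L ≤ L * W := by
    intro h
    rw [mul_comm]; exact mul_le_mul_of_nonneg_left (hW3 h) (by linarith)
  generalize L * W = Z at *
  have hA0 : 0 < A := by linarith
  constructor
  · have hW : A < Z^2 := by nlinarith
    have h4 : A * (Y * Z^2) ≤ A * A := by linarith
    have h5 : Y * Z^2 ≤ A := le_of_mul_le_mul_left h4 hA0
    by_contra h
    push Not at h
    have : 1 * Z^2 ≤ Y * Z^2 := by gcongr
    linarith
  · have hW : A^2 < 2 * Z^2 := by
      by_cases h3' : A < 3
      · nlinarith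
      · push Not at h3'
        have := hLW3 h3'
        have h6 : (71 / 100 * L)^2 ≤ Z^2 := by gcongr
        have h7 : A^2 < L^2 := by gcongr
        nlinarith
    by_contra h
    push Not at h
    have : 2 * Z^2 ≤ A * Y * Z^2 := by gcongr
    linarith

set_option maxHeartbeats 1000000 in
lemma num2 (k : ℕ) (hk : 213 ≤ k) (L A μ τ : ℝ) (hL : L = Real.log k) (hA : A = L - 2 * Real.log L)
   (hτ : τ = (Real.exp A - 1) / (A * k)) (hμ : μ = 1 / (1 - Real.exp (-A)) - 1 / A) :
   0 < 1 - τ - μ ∧ 0 < 1 - τ * μ / (1 - τ - μ)^2 ∧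
    A - 2 < A / (1 - Real.exp (-A)) * (1 - τ * μ / (1 - τ - μ)^2) ∧ 0 < τ ∧ τ ≤ 1 ∧ 0 < μ := by
  obtain ⟨h1, h2, h3, h4⟩ := num_final k hk L A hL hA
  have hk0 : (213:ℝ) ≤ k := by exact_mod_cast hk
  norm_num at h1 h2
  have hA0 : 0 < A := by linarith
  have hL0 : 0 < L := by linarith
  have hE : 1 + A + A^2/2 + A^3/6 ≤ Real.exp A := by
    have := Real.sum_le_exp_of_nonneg hA0.le 4
    simp [Finset.sum_range_succ, Nat.factorial] at this
    linarith
  set E := Real.exp A with hEd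
  have hEk : E = k / L^2 := h4
  have hE1 : 1 < E := by nlinarith [pow_pos hA0 2, pow_pos hA0 3]
  have hi : Real.exp (-A) = 1 / E := by rw [Real.exp_neg, one_div]
  have hkL : (k:ℝ) = E * L^2 := by rw [hEk]; field_simp
  rw [hi] at hμ ⊢
  have hτ1 : τ * (A * L^2) ≤ 1 := by
    rw [hτ, hkL]
    have : (E - 1) / (A * (E * L ^ 2)) * (A * L ^ 2) = (E-1)/E := by field_simp
    rw [this, div_le_one (by linarith)]; linarith
  have hτ0 : 0 < τ := by
    rw [hτ]; apply div_pos (by linarith) (by positivity)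
  have hE2 : 0 < E - 1 := by linarith
  have hμ2 : A * (1 - μ) = 1 - A / (E - 1) := by
    rw [hμ]
    have : (1 - 1/E) ≠ 0 := by
      have : 1/E < 1 := by rw [div_lt_one (by linarith)]; exact hE1
      linarith
    have h5 : 1 / (1 - 1/E) = 1 + 1/(E-1) := by
      have : E ≠ 0 := by linarith
      field_simp
      ring
    rw [h5]; field_simp; ring
  have hAE : A / (E - 1) ≤ 1 / (1 + A/2 + A^2/6) := by
    rw [div_le_div_iff₀ hE2 (by positivity)]; nlinarith
  have hτ2 : A * τ ≤ 1 / 27 := by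
    have : L^2 ≥ 27 := by nlinarith
    have : 0 < A * τ := by positivity
    nlinarith
  have hq : 1 - A/(E-1) - 1/27 ≤ A * (1 - τ - μ) := by
    have : A * (1 - τ - μ) = A * (1-μ) - A * τ := by ring
    rw [this, hμ2]; linarith
  set Q := 1 - τ - μ with hQ
  have hq1 : 0.55 ≤ A * Q := by
    have : 1 / (1 + A/2 + A^2/6) ≤ 0.41 := by
      rw [div_le_iff₀ (by positivity)]; norm_num; nlinarith
    norm_num at *
    linarith
  have hQ0 : 0 < Q := by
    by_contra h
    push Not at h
    norm_num at hq1
    nlinarith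
  have hμ1 : μ ≤ 1 := by linarith
  have hμ0 : 0 < μ := by
    rw [hμ]
    have : 1 - 1/E < 1 := by have : 0 < 1/E := by positivity
                             linarith
    have h6 : 0 < 1 - 1/E := by
      have : 1/E < 1 := by rw [div_lt_one (by linarith)]; exact hE1
      linarith
    have h5 : 1 / (1 - 1/E) > 1 := by rw [gt_iff_lt, lt_div_iff₀ h6]; linarith
    have h7 : 1 / A < 1 := by rw [div_lt_one hA0]; linarith
    linarith
  have hX : A * (τ * μ / Q^2) * (L * (A * Q))^2 ≤ A^2 := by
    have : A * (τ * μ / Q^2) * (L * (A * Q))^2 = A^2 * (τ * (A * L^2)) * μ := by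
      field_simp
    rw [this]
    have h8 : τ * (A * L^2) * μ ≤ 1 := by
      calc _ ≤ 1 * μ := by gcongr
        _ ≤ 1 := by linarith
    nlinarith [sq_nonneg A]
  set Y := τ * μ / Q^2 with hY
  have hY0 : 0 < Y := by positivity
  have hLq : 0.55 * L ≤ L * (A * Q) := by rw [mul_comm]; exact mul_le_mul_of_nonneg_left hq1 hL0.le
  obtain ⟨hlt1, hlt2⟩ := num_aux L A (A * Q) Y h1 h2 h3 (by norm_num at hq1; linarith) (by
    intro h3'
    have : 1 / (1 + A/2 + A^2/6) ≤ 0.25 := by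
      rw [div_le_iff₀ (by positivity)]; norm_num; nlinarith
    have h025 : (0.25:ℝ) = 1 / 4 := by norm_num
    rw [h025] at this
    linarith) hX
  refine ⟨hQ0, by linarith, ?_, hτ0, ?_, hμ0⟩
  · have h6 : 0 < 1 - 1/E := by
      have : 1/E < 1 := by rw [div_lt_one (by linarith)]; exact hE1
      linarith
    have h7 : A ≤ A / (1 - 1/E) := by
      rw [le_div_iff₀ h6]
      have : 0 < A * (1/E) := by positivity
      linarith
    nlinarith
  · nlinarith

lemma int_small (w : ℝ → ℝ) (τ δ : ℝ) (hw : Continuous w) (hδ : 0 < δ) (hδτ : 2 * δ < τ)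
    (h1 : ∀ x, w x ≤ 1) (h0 : ∀ x, δ ≤ x → x ≤ τ - δ → w x ≤ 0) :
    ∫ x in (0:ℝ)..τ, w x ≤ 2 * δ := by
  have hi : ∀ a b, IntervalIntegrable w volume a b := fun a b => hw.intervalIntegrable a b
  rw [← intervalIntegral.integral_add_adjacent_intervals (hi 0 δ) (hi δ τ),
    ← intervalIntegral.integral_add_adjacent_intervals (hi δ (τ - δ)) (hi (τ - δ) τ)]
  have a1 : ∫ x in (0:ℝ)..δ, w x ≤ ∫ x in (0:ℝ)..δ, (1:ℝ) :=
    intervalIntegral.integral_mono_on hδ.le (hi _ _) (by simp) fun x _ => h1 x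
  have a2 : ∫ x in δ..(τ - δ), w x ≤ ∫ x in δ..(τ-δ), (0:ℝ) :=
    intervalIntegral.integral_mono_on (by linarith) (hi _ _) (by simp) fun x hx => h0 x hx.1 hx.2
  have a3 : ∫ x in (τ - δ)..τ, w x ≤ ∫ x in (τ - δ)..τ, (1:ℝ) :=
    intervalIntegral.integral_mono_on (by linarith) (hi _ _) (by simp) fun x _ => h1 x
  simp at a1 a2 a3
  linarith

lemma nu01_trunc (f : ℝ → ℝ) (τ : ℝ) (hf : Continuous f) (hτ1 : τ ≤ 1)
    (hz : ∀ x, τ ≤ x → f x = 0) : ∫ x, f x ∂nu01 = ∫ x in (0:ℝ)..τ, f x := by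
  have hi : ∀ a b, IntervalIntegrable f volume a b := fun a b => hf.intervalIntegrable a b
  rw [← nu01_interval, ← intervalIntegral.integral_add_adjacent_intervals (hi 0 τ) (hi τ 1)]
  have : ∫ x in τ..1, f x = ∫ x in τ..1, (0:ℝ) := by
    apply intervalIntegral.integral_congr
    intro x hx
    rw [Set.uIcc_of_le hτ1] at hx
    exact hz x hx.1
  rw [this]; simp

lemma approx (B τ δ : ℝ) (hB : 0 < B) (hτ0 : 0 < τ) (hτ1 : τ ≤ 1) (hδ : 0 < δ) (hδτ : 2 * δ < τ) :
    ∃ g : ℝ → ℝ, ContDiff ℝ (⊤ : ℕ∞) g ∧ (∀ x, 0 ≤ g x) ∧ (∀ x, g x ≠ 0 → 0 ≤ x ∧ x ≤ τ) ∧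
      Real.log (1 + B * τ) / B - 2 * δ ≤ ∫ x, g x ∂nu01 ∧
      (1 - 1 / (1 + B * τ)) / B - 2 * δ ≤ ∫ x, g x ^ 2 ∂nu01 ∧
      ∫ x, g x ^ 2 ∂nu01 ≤ (1 - 1 / (1 + B * τ)) / B ∧
      ∫ x, x * g x ^ 2 ∂nu01 ≤ (Real.log (1 + B * τ) - 1 + 1 / (1 + B * τ)) / B^2 := by
  set φ : ℝ → ℝ := fun x => Real.smoothTransition (x / δ) * Real.smoothTransition ((τ - x) / δ)
    with hφ
  have hφs : ContDiff ℝ (⊤ : ℕ∞) φ := by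
    apply ContDiff.mul
    · apply Real.smoothTransition.contDiff.comp; fun_prop
    · apply Real.smoothTransition.contDiff.comp; fun_prop
  have hφ0 : ∀ x, 0 ≤ φ x := fun x =>
    mul_nonneg (Real.smoothTransition.nonneg _) (Real.smoothTransition.nonneg _)
  have hφ1 : ∀ x, φ x ≤ 1 := fun x =>
    mul_le_one₀ (Real.smoothTransition.le_one _) (Real.smoothTransition.nonneg _)
      (Real.smoothTransition.le_one _)
  have hφl : ∀ x, x ≤ 0 → φ x = 0 := by
    intro x hx
    simp only [hφ]
    rw [Real.smoothTransition.zero_of_nonpos (div_nonpos_of_nonpos_of_nonneg hx hδ.le), zero_mul]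
  have hφr : ∀ x, τ ≤ x → φ x = 0 := by
    intro x hx
    simp only [hφ]
    rw [Real.smoothTransition.zero_of_nonpos (x := (τ - x) / δ)
      (div_nonpos_of_nonpos_of_nonneg (by linarith) hδ.le), mul_zero]
  have hφm : ∀ x, δ ≤ x → x ≤ τ - δ → φ x = 1 := by
    intro x h1 h2
    simp only [hφ]
    rw [Real.smoothTransition.one_of_one_le, Real.smoothTransition.one_of_one_le, one_mul]
    · rw [le_div_iff₀ hδ]; linarith
    · rw [le_div_iff₀ hδ]; linarith
  set u : ℝ → ℝ := fun x => (1 + B * max x 0)⁻¹ with hu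
  have hd : ∀ x, 1 ≤ 1 + B * max x 0 := by
    intro x
    have := mul_nonneg hB.le (le_max_right x 0)
    linarith
  have huc : Continuous u := by
    apply Continuous.inv₀ (by fun_prop)
    intro x; linarith [hd x]
  have hu0 : ∀ x, 0 < u x := fun x => inv_pos.mpr (by linarith [hd x])
  have hu1 : ∀ x, u x ≤ 1 := fun x => inv_le_one_of_one_le₀ (hd x)
  have hux : ∀ x, 0 ≤ x → u x = (1 + B * x)⁻¹ := by
    intro x hx; simp only [hu]; rw [max_eq_left hx]
  set g : ℝ → ℝ := fun x => φ x * u x with hg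
  have hgc : Continuous g := hφs.continuous.mul huc
  have hgs : ContDiff ℝ (⊤ : ℕ∞) g := by
    have : g = fun x => φ x * (1 + B * x)⁻¹ := by
      funext x
      by_cases hx : x ≤ 0
      · simp [hg, hφl x hx]
      · simp only [hg]; rw [hux x (by linarith)]
    rw [this, contDiff_iff_contDiffAt]
    intro x
    by_cases hx : x < 0
    · apply (contDiffAt_const (c := (0:ℝ))).congr_of_eventuallyEq
      filter_upwards [Iio_mem_nhds hx] with y hy
      rw [hφl y (le_of_lt hy), zero_mul]
    · push Not at hx
      apply hφs.contDiffAt.mul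
      apply ContDiffAt.inv
      · fun_prop
      · have := mul_nonneg hB.le hx
        linarith
  have hgu : ∀ x, g x ≤ u x := fun x => mul_le_of_le_one_left (hu0 x).le (hφ1 x)
  have hg0 : ∀ x, 0 ≤ g x := fun x => mul_nonneg (hφ0 x) (hu0 x).le
  have hgr : ∀ x, τ ≤ x → g x = 0 := fun x hx => by simp [hg, hφr x hx]
  have hgm : ∀ x, δ ≤ x → x ≤ τ - δ → g x = u x := fun x h1 h2 => by simp [hg, hφm x h1 h2]
  have hpos : ∀ x ∈ Set.uIcc 0 τ, 0 < 1 + B * x := by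
    intro x hx
    rw [Set.uIcc_of_le hτ0.le] at hx
    have := mul_nonneg hB.le hx.1
    linarith
  have huI : ∀ x ∈ Set.uIcc 0 τ, u x = (1 + B * x)⁻¹ := by
    intro x hx
    rw [Set.uIcc_of_le hτ0.le] at hx
    exact hux x hx.1
  have hl : ∀ x ∈ Set.uIcc 0 τ, HasDerivAt (fun x => 1 + B * x) B x := by
    intro x _
    simpa using ((hasDerivAt_id x).const_mul B).const_add 1
  have hu2 : Continuous fun x => u x ^ 2 := by fun_prop
  have hg2 : Continuous fun x => g x ^ 2 := by fun_prop
  have hxu2 : Continuous fun x => x * u x ^ 2 := by fun_prop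
  have hxg2 : Continuous fun x => x * g x ^ 2 := by fun_prop
  have i1 : ∫ x in (0:ℝ)..τ, u x = Real.log (1 + B * τ) / B := by
    rw [intervalIntegral.integral_eq_sub_of_hasDerivAt (f := fun x => Real.log (1 + B * x) / B)
      _ (huc.intervalIntegrable _ _)]
    · simp
    · intro x hx
      refine (((hl x hx).log (hpos x hx).ne').div_const B).congr_deriv ?_
      rw [huI x hx]
      field_simp
  have i2 : ∫ x in (0:ℝ)..τ, u x ^ 2 = (1 - 1 / (1 + B * τ)) / B := by
    rw [intervalIntegral.integral_eq_sub_of_hasDerivAt (f := fun x => - (1 + B * x)⁻¹ / B)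
      _ (hu2.intervalIntegrable _ _)]
    · simp; ring
    · intro x hx
      refine ((((hl x hx).fun_inv (hpos x hx).ne').fun_neg).div_const B).congr_deriv ?_
      rw [huI x hx]
      have := (hpos x hx).ne'
      field_simp
  have i3 : ∫ x in (0:ℝ)..τ, x * u x ^ 2
      = (Real.log (1 + B * τ) - 1 + 1 / (1 + B * τ)) / B^2 := by
    rw [intervalIntegral.integral_eq_sub_of_hasDerivAt
      (f := fun x => (Real.log (1 + B * x) + (1 + B * x)⁻¹) / B^2)
      _ (hxu2.intervalIntegrable _ _)]
    · simp; ring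
    · intro x hx
      refine ((((hl x hx).log (hpos x hx).ne').fun_add
        ((hl x hx).fun_inv (hpos x hx).ne')).div_const (B^2)).congr_deriv ?_
      rw [huI x hx]
      have := (hpos x hx).ne'
      field_simp
      ring
  refine ⟨g, hgs, hg0, ?_, ?_, ?_, ?_, ?_⟩
  · intro x hx
    constructor
    · by_contra h; push Not at h; apply hx; simp [hg, hφl x h.le]
    · by_contra h; push Not at h; exact hx (hgr x h.le)
  · rw [nu01_trunc g τ hgc hτ1 hgr, ← i1]
    have := int_small (fun x => u x - g x) τ δ (by fun_prop) hδ hδτ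
      (fun x => by linarith [hu1 x, hg0 x]) (fun x h1 h2 => by simp [hgm x h1 h2])
    rw [intervalIntegral.integral_sub (huc.intervalIntegrable _ _) (hgc.intervalIntegrable _ _)] at this
    linarith
  · rw [nu01_trunc (fun x => g x ^ 2) τ (by fun_prop) hτ1 (fun x hx => by simp [hgr x hx]), ← i2]
    have := int_small (fun x => u x ^ 2 - g x ^ 2) τ δ (by fun_prop) hδ hδτ
      (fun x => by linarith [pow_le_one₀ (n := 2) (hu0 x).le (hu1 x), sq_nonneg (g x)])
      (fun x h1 h2 => by simp [hgm x h1 h2])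
    rw [intervalIntegral.integral_sub (hu2.intervalIntegrable _ _)
      (hg2.intervalIntegrable _ _)] at this
    linarith
  · rw [nu01_trunc (fun x => g x ^ 2) τ (by fun_prop) hτ1 (fun x hx => by simp [hgr x hx]), ← i2]
    apply intervalIntegral.integral_mono_on hτ0.le (hg2.intervalIntegrable _ _)
      (hu2.intervalIntegrable _ _)
    intro x _
    exact pow_le_pow_left₀ (hg0 x) (hgu x) 2
  · rw [nu01_trunc (fun x => x * g x ^ 2) τ (by fun_prop) hτ1 (fun x hx => by simp [hgr x hx]), ← i3]
    apply intervalIntegral.integral_mono_on hτ0.le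
      (hxg2.intervalIntegrable _ _)
      (hxu2.intervalIntegrable _ _)
    intro x hx
    exact mul_le_mul_of_nonneg_left (pow_le_pow_left₀ (hg0 x) (hgu x) 2) hx.1

/-- the core bound with unnormalised `g` -/
lemma core2 (k : ℕ) (hk : 1 ≤ k) (g : ℝ → ℝ) (τ ε γ0 γ1 G m M : ℝ) (hg : ContDiff ℝ (⊤ : ℕ∞) g)
    (hg0 : ∀ x, 0 ≤ g x) (hs : ∀ x, g x ≠ 0 → 0 ≤ x ∧ x ≤ τ) (hτ0 : 0 ≤ τ) (hτ : τ ≤ 1) (hε : 0 < ε)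
    (hγ1 : 0 < γ1) (h1 : γ1 ≤ ∫ x, g x ^ 2 ∂nu01) (h0 : ∫ x, g x ^ 2 ∂nu01 ≤ γ0)
    (hm : ∫ x, x * g x ^ 2 ∂nu01 ≤ m) (hM : M = k * m / γ1)
    (hD : 0 < 1 - ε - τ - M) (hX : 0 < 1 - τ * M / (1 - ε - τ - M)^2)
    (hG : 0 < G) (hGg : G ≤ ∫ x, g x ∂nu01) :
    k * G^2 / γ0 * (1 - τ * M / (1 - ε - τ - M)^2) ≤ maynardM k := by
  set γ := ∫ x, g x ^ 2 ∂nu01 with hγ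
  have hγ0 : 0 < γ := by linarith
  have hsq : (√γ)^2 = γ := Real.sq_sqrt hγ0.le
  have hsp : 0 < √γ := Real.sqrt_pos.mpr hγ0
  set I := ∫ x, g x ∂nu01 with hI
  have e1 : ∀ x, (g x / √γ)^2 = g x ^ 2 / γ := fun x => by rw [div_pow, hsq]
  have e2 : ∫ x, (g x / √γ) ∂nu01 = I / √γ := integral_div _ _
  set m' := (∫ x, x * g x ^ 2 ∂nu01) with hm'
  have hm0 : 0 ≤ m' := by
    apply integral_nonneg
    intro x
    by_cases hx : g x = 0
    · simp [hx]
    · exact mul_nonneg (hs x hx).1 (sq_nonneg _)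
  have hmm : 0 ≤ m := hm0.trans hm
  have hMm : k * (m' / γ) ≤ M := by
    rw [hM, mul_div_assoc]
    gcongr
  have hM0 : 0 ≤ k * (m' / γ) := by positivity
  have hMM : 0 ≤ M := hM0.trans hMm
  have hle : k * τ * (m' / γ) / (1 - ε - τ - k * (m' / γ))^2 ≤ τ * M / (1 - ε - τ - M)^2 := by
    have : k * τ * (m' / γ) = τ * (k * (m'/γ)) := by ring
    rw [this]
    have hτM : 0 ≤ τ * M := mul_nonneg hτ0 hMM
    gcongr
  have hkey := core k hk (fun x => g x / √γ) τ ε (m' / γ) (hg.div_const _)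
    (fun x => div_nonneg (hg0 x) hsp.le) (fun x hx => hs x (by
      intro h; apply hx; simp [h])) hτ hε
    (by simp_rw [e1]; rw [integral_div, ← hγ, div_self hγ0.ne'])
    (by simp_rw [e1, ← mul_div_assoc]; rw [integral_div])
    (by linarith) (by linarith) (by rw [e2]; apply div_pos (by linarith) hsp)
  refine le_trans ?_ hkey
  rw [e2, div_pow, hsq, ← mul_div_assoc]
  gcongr

theorem maynardM_lower_bound (k : ℕ) (hk : 213 ≤ k) :
    Real.log k - 2 * Real.log (Real.log k) - 2 < maynardM k := by
  set L := Real.log k with hL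
  set A := L - 2 * Real.log L with hA
  obtain ⟨h5, hA1, -, -⟩ := num_final k hk L A hL hA
  have hA0 : 0 < A := lt_of_lt_of_le (by norm_num) hA1
  have hk0 : (0:ℝ) < k := by
    have : (213:ℝ) ≤ k := by exact_mod_cast hk
    linarith
  obtain ⟨τ, hτ⟩ : ∃ τ, τ = (Real.exp A - 1) / (A * k) := ⟨_, rfl⟩
  obtain ⟨μ, hμ⟩ : ∃ μ, μ = 1 / (1 - Real.exp (-A)) - 1 / A := ⟨_, rfl⟩
  obtain ⟨n1, n2, n3, n4, n5, n6⟩ := num2 k hk L A μ τ hL hA hτ hμ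
  have hB : 0 < A * k := by positivity
  have hBτ : 1 + A * k * τ = Real.exp A := by rw [hτ]; field_simp; ring
  have hE : Real.exp (-A) < 1 := by rw [Real.exp_lt_one_iff]; linarith
  have hE' : 1 / Real.exp A = Real.exp (-A) := by rw [Real.exp_neg, one_div]
  have hE1 : 0 < 1 - Real.exp (-A) := by linarith
  set γ0 := (1 - Real.exp (-A)) / (A * k) with hγ0
  set m0 := (A - 1 + Real.exp (-A)) / (A * k)^2 with hm0
  have hγp : 0 < γ0 := by positivity
  set M : ℝ → ℝ := fun δ => k * m0 / (γ0 - 2 * δ) with hM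
  have hM0 : M 0 = μ := by
    simp only [hM, hμ, hγ0, hm0]
    rw [mul_zero, sub_zero]
    field_simp
    ring
  have cM : ContinuousAt M 0 := by
    apply ContinuousAt.div (by fun_prop) (by fun_prop)
    simpa using hγp.ne'
  have cD : ContinuousAt (fun δ => 1 - δ - τ - M δ) 0 := by fun_prop
  have cX : ContinuousAt (fun δ => 1 - τ * M δ / (1 - δ - τ - M δ)^2) 0 := by
    apply ContinuousAt.sub (by fun_prop)
    apply ContinuousAt.div (by fun_prop) (by fun_prop)
    simp only [hM0, sub_zero]
    positivity
  have cP : ContinuousAt (fun δ => k * (1 / k - 2 * δ)^2 / γ0 *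
      (1 - τ * M δ / (1 - δ - τ - M δ)^2)) 0 := by
    apply ContinuousAt.mul (by fun_prop) cX
  have v1 := cD.eventually_const_lt (u := 0) (by simpa [hM0] using n1)
  have v2 := cX.eventually_const_lt (u := 0) (by simpa [hM0] using n2)
  have v3 := cP.eventually_const_lt (u := A - 2) (by
    simp only [hM0, sub_zero, mul_zero]
    have : k * (1 / (k:ℝ))^2 / γ0 = A / (1 - Real.exp (-A)) := by
      rw [hγ0]; field_simp
    rw [this]; exact n3)
  have v4 : ∀ᶠ δ : ℝ in nhds 0, δ < min (τ / 2) (min (γ0 / 2) (1 / (2 * k))) :=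
    Iio_mem_nhds (by positivity)
  have hall := ((v1.and v2).and (v3.and v4)).filter_mono (nhdsWithin_le_nhds (s := Set.Ioi (0:ℝ)))
  obtain ⟨δ, ⟨⟨w1, w2⟩, w3, w4⟩, hδ⟩ := (hall.and self_mem_nhdsWithin).exists
  have hδ0 : 0 < δ := hδ
  rw [lt_min_iff, lt_min_iff] at w4
  obtain ⟨g, g1, g2, g3, g4, g5, g6, g7⟩ := approx (A * k) τ δ hB n4 n5 hδ0 (by linarith [w4.1])
  rw [hBτ] at g4 g5 g6 g7
  rw [Real.log_exp] at g4 g7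
  rw [hE'] at g5 g6 g7
  have hAk : A / (A * k) = 1 / k := by field_simp
  rw [hAk] at g4
  refine lt_of_lt_of_le w3 (core2 k (by omega) g τ δ γ0 (γ0 - 2 * δ) (1 / k - 2 * δ) m0 (M δ)
    g1 g2 g3 n4.le n5 hδ0 (by linarith [w4.2.1]) g5 g6 g7 rfl w1 w2 ?_ g4)
  have h8 := w4.2.2
  have : 1 / (2 * (k:ℝ)) = 1 / k / 2 := by field_simp
  rw [this] at h8
  linarith
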